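/- Let g : ℝ^d → ℝ^d be measurable, σ_g > 0, η > 0, L ≥ 1, and let M be a positive definite d×d real matrix. For s > 0 let K_s be the Markov kernel on ℝ^{2d} with K_s((θ, p), ·) the law of (θ, −p + s·g(θ) + s·σ_g·Z), Z ∼ N(0, I_d), and let D be the Dirac kernel of the map (θ, p) ↦ (θ − ηM⁻¹p, −p). Let Q be the symmetric composition Q = K_{η/2} ∘ D ∘ K_η ∘ D ∘ ⋯ ∘ K_η ∘ D ∘ K_{η/2}, containing L copies of D and L − 1 copies of K_η between the two outer K_{η/2} factors (this is the kernel of the noisy leapfrog simulation of DP-HMC followed by a momentum flip, l_− ∘ l). Then Q is reversible with respect to the Lebesgue measure on ℝ^{2d}. -/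

import Mathlib

open MeasureTheory ProbabilityTheory Matrix

/-- A Markov kernel `q` is reversible with respect to a measure `μ` if
`∫_A μ(da) ∫_B q(a, db) = ∫_B μ(db) ∫_A q(b, da)` for all measurable sets `A`, `B`. -/
def Reversible {E : Type*} [MeasurableSpace E] (q : Kernel E E) (μ : Measure E) : Prop :=
  ∀ A B : Set E, MeasurableSet A → MeasurableSet B →
    ∫⁻ a in A, q a B ∂μ = ∫⁻ b in B, q b A ∂μ

/-- The Gaussian measure `N(m, σ²I_n)` on `ℝ^n` (with variance `v = σ²`), as the product of
one-dimensional Gaussian measures. -/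
noncomputable def gaussPi (n : ℕ) (m : Fin n → ℝ) (v : NNReal) : Measure (Fin n → ℝ) :=
  Measure.pi fun j => gaussianReal (m j) v

/-- `iterComp κ n = κ ∘ₖ ⋯ ∘ₖ κ` (`n` factors). -/
noncomputable def iterComp {E : Type*} [MeasurableSpace E] (κ : Kernel E E) : ℕ → Kernel E E
  | 0 => Kernel.id
  | n + 1 => κ ∘ₖ iterComp κ n

/-- Adjointness of kernels with respect to a measure. -/
def KAdj {E : Type*} [MeasurableSpace E] (q q' : Kernel E E) (μ : Measure E) : Prop :=
  ∀ f h : E → ENNReal, Measurable f → Measurable h →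
    ∫⁻ a, f a * ∫⁻ b, h b ∂(q a) ∂μ = ∫⁻ b, h b * ∫⁻ a, f a ∂(q' b) ∂μ

theorem KAdj.comp {E : Type*} [MeasurableSpace E] {q₁ q₁' q₂ q₂' : Kernel E E} {μ : Measure E}
    (h₁ : KAdj q₁ q₁' μ) (h₂ : KAdj q₂ q₂' μ) : KAdj (q₂ ∘ₖ q₁) (q₁' ∘ₖ q₂') μ := by
  intro f h hf hh
  simp_rw [Kernel.lintegral_comp _ _ _ hh, Kernel.lintegral_comp _ _ _ hf]
  rw [h₁ f _ hf hh.lintegral_kernel, ← h₂ _ h hf.lintegral_kernel hh]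
  simp_rw [mul_comm]

theorem KAdj.id {E : Type*} [MeasurableSpace E] {μ : Measure E} :
    KAdj (Kernel.id : Kernel E E) Kernel.id μ := by
  intro f h hf hh
  simp_rw [Kernel.id_apply, lintegral_dirac' _ hf, lintegral_dirac' _ hh, mul_comm]

theorem iterComp_comm {E : Type*} [MeasurableSpace E] (D K : Kernel E E) (n : ℕ) :
    iterComp (D ∘ₖ K) n ∘ₖ D = D ∘ₖ iterComp (K ∘ₖ D) n := by
  induction n with
  | zero => simp [iterComp]
  | succ n ih => simp only [iterComp, Kernel.comp_assoc, ih]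

theorem iterComp_succ' {E : Type*} [MeasurableSpace E] (K : Kernel E E) (n : ℕ) :
    iterComp K (n + 1) = iterComp K n ∘ₖ K := by
  induction n with
  | zero => simp [iterComp]
  | succ n ih =>
    conv_lhs => rw [iterComp, ih, ← Kernel.comp_assoc]
    rfl

theorem KAdj.iter {E : Type*} [MeasurableSpace E] {q q' : Kernel E E} {μ : Measure E}
    (h : KAdj q q' μ) (n : ℕ) : KAdj (iterComp q n) (iterComp q' n) μ := by
  induction n with
  | zero => exact KAdj.id
  | succ n ih =>
    rw [iterComp_succ' q']
    exact ih.comp h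

theorem KAdj.reversible {E : Type*} [MeasurableSpace E] {q : Kernel E E} {μ : Measure E}
    (h : KAdj q q μ) : Reversible q μ := by
  intro A B hA hB
  have := h (A.indicator 1) (B.indicator 1) (measurable_one.indicator hA)
    (measurable_one.indicator hB)
  simp_rw [lintegral_indicator_one hA, lintegral_indicator_one hB] at this
  rw [← lintegral_indicator hA, ← lintegral_indicator hB]
  convert this using 3 with a a
  · by_cases ha : a ∈ A <;> simp [ha]
  · by_cases ha : a ∈ B <;> simp [ha]

instance gaussPi_prob (n : ℕ) (m : Fin n → ℝ) (v : NNReal) :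
    IsProbabilityMeasure (gaussPi n m v) := by
  unfold gaussPi; infer_instance

theorem gaussPi_map (n : ℕ) (m : Fin n → ℝ) (v : NNReal) :
    gaussPi n m v = (gaussPi n 0 v).map (fun z => m + z) := by
  unfold gaussPi
  have := Measure.pi_map_pi (μ := fun _ : Fin n => gaussianReal 0 v)
    (f := fun i (x : ℝ) => m i + x) (fun i => by fun_prop)
  simp only [gaussianReal_map_const_add, zero_add] at this
  exact this.symm

theorem K_adj (d : ℕ) (g : (Fin d → ℝ) → (Fin d → ℝ)) (hg : Measurable g) (s : ℝ) (v : NNReal)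
    (K : Kernel ((Fin d → ℝ) × (Fin d → ℝ)) ((Fin d → ℝ) × (Fin d → ℝ)))
    (hK : ∀ θ p, K (θ, p) = (Measure.dirac θ).prod (gaussPi d (-p + s • g θ) v)) :
    KAdj K K volume := by
  have key : ∀ h : (Fin d → ℝ) × (Fin d → ℝ) → ENNReal, Measurable h → ∀ θ p,
      ∫⁻ b, h b ∂(K (θ, p)) = ∫⁻ z, h (θ, -p + s • g θ + z) ∂(gaussPi d 0 v) := by
    intro h hh θ p
    rw [hK, Measure.dirac_prod, lintegral_map hh (by fun_prop), gaussPi_map,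
      lintegral_map (by fun_prop) (by fun_prop)]
  have main : ∀ f h : (Fin d → ℝ) × (Fin d → ℝ) → ENNReal, Measurable f → Measurable h →
      ∫⁻ a, f a * ∫⁻ b, h b ∂(K a) = ∫⁻ θ, ∫⁻ z, ∫⁻ p, f (θ, p) * h (θ, -p + s • g θ + z)
        ∂volume ∂(gaussPi d 0 v) ∂volume := by
    intro f h hf hh
    rw [Measure.volume_eq_prod, lintegral_prod _ (by
      exact (hf.mul hh.lintegral_kernel).aemeasurable)]
    congr 1; ext θ
    rw [lintegral_lintegral_swap (by
      apply Measurable.aemeasurable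
      unfold Function.uncurry
      fun_prop)]
    congr 1; ext p
    rw [key h hh, lintegral_const_mul _ (by fun_prop)]
  intro f h hf hh
  rw [main f h hf hh, main h f hh hf]
  congr 1; ext θ
  congr 1; ext z
  rw [← lintegral_sub_left_eq_self _ (s • g θ + z)]
  congr 1; ext p
  rw [mul_comm]
  congr 3 <;> abel_nf

theorem D_adj (d : ℕ) (η : ℝ) (M : Matrix (Fin d) (Fin d) ℝ)
    (D : Kernel ((Fin d → ℝ) × (Fin d → ℝ)) ((Fin d → ℝ) × (Fin d → ℝ)))
    (hD : ∀ θ p : Fin d → ℝ, D (θ, p) = Measure.dirac (θ - η • M.mulVec p, -p)) :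
    KAdj D D volume := by
  have hmul : Measurable (fun p : Fin d → ℝ => M.mulVec p) :=
    (Continuous.matrix_mulVec continuous_const continuous_id).measurable
  have main : ∀ f h : (Fin d → ℝ) × (Fin d → ℝ) → ENNReal, Measurable f → Measurable h →
      ∫⁻ a, f a * ∫⁻ b, h b ∂(D a) = ∫⁻ p, ∫⁻ θ, f (θ, p) * h (θ - η • M.mulVec p, -p) := by
    intro f h hf hh
    rw [Measure.volume_eq_prod, lintegral_prod_symm _ (by
      exact (hf.mul hh.lintegral_kernel).aemeasurable)]
    simp_rw [hD, lintegral_dirac' _ hh]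
  intro f h hf hh
  rw [main f h hf hh, main h f hh hf, ← lintegral_neg_eq_self]
  congr 1; ext p
  rw [← lintegral_sub_right_eq_self _ (η • M.mulVec p)]
  congr 1; ext θ
  rw [mul_comm]
  simp [Matrix.mulVec_neg]

/-- The DP-HMC noisy leapfrog proposal kernel with momentum flip,
`Q = K_{η/2} ∘ D ∘ K_η ∘ D ∘ ⋯ ∘ K_η ∘ D ∘ K_{η/2}` (applied right-to-left, with `L` copies of
`D` and `L − 1` copies of `K_η` between the two outer `K_{η/2}` factors), where
`K_s((θ, p), ·)` is the law of `(θ, −p + s·g(θ) + s·σ_g·Z)` with `Z ∼ N(0, I_d)` and `D` is the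
Dirac kernel of `(θ, p) ↦ (θ − ηM⁻¹p, −p)`, is reversible with respect to the Lebesgue measure
on `ℝ^{2d}` (Corollary `dp_hmc_leapfrog_reversibility_lemma`). -/
theorem dp_hmc_leapfrog_proposal_reversible
    (d : ℕ) (g : (Fin d → ℝ) → (Fin d → ℝ)) (hg : Measurable g)
    (σg η : ℝ) (hσg : 0 < σg) (hη : 0 < η) (L : ℕ) (hL : 1 ≤ L)
    (M : Matrix (Fin d) (Fin d) ℝ) (hM : M.PosDef)
    (K : ℝ → Kernel ((Fin d → ℝ) × (Fin d → ℝ)) ((Fin d → ℝ) × (Fin d → ℝ)))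
    [∀ s, IsMarkovKernel (K s)]
    (hK : ∀ s θ p, K s (θ, p)
      = (Measure.dirac θ).prod (gaussPi d (-p + s • g θ) (Real.toNNReal ((s * σg) ^ 2))))
    (D : Kernel ((Fin d → ℝ) × (Fin d → ℝ)) ((Fin d → ℝ) × (Fin d → ℝ)))
    [IsMarkovKernel D]
    (hD : ∀ θ p : Fin d → ℝ, D (θ, p) = Measure.dirac (θ - η • M⁻¹.mulVec p, -p))
    (Q : Kernel ((Fin d → ℝ) × (Fin d → ℝ)) ((Fin d → ℝ) × (Fin d → ℝ)))
    (hQ : Q = K (η / 2) ∘ₖ (iterComp (D ∘ₖ K η) (L - 1) ∘ₖ (D ∘ₖ K (η / 2)))) :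
    Reversible Q (volume : Measure ((Fin d → ℝ) × (Fin d → ℝ))) := by
  have hKa : ∀ s, KAdj (K s) (K s) volume := fun s => K_adj d g hg s _ (K s) (hK s)
  have hDa : KAdj D D volume := D_adj d η M⁻¹ D hD
  have := ((((hKa (η / 2)).comp hDa).comp (((hKa η).comp hDa).iter (L - 1))).comp (hKa (η / 2)))
  apply KAdj.reversible
  rw [hQ]
  convert this using 1
  simp only [Kernel.comp_assoc]
  rw [← Kernel.comp_assoc D, ← iterComp_comm, Kernel.comp_assoc]
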